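/- Let X be a separable real Banach space with Property(M) such that ℓ₁ does not embed isomorphically into X. Then the dual X* is separable and X* has a weak* Kadec-Klee norm. -/

import Mathlib

open Filter Topology ZeroAtInfty

/-- A sequence converges weakly to zero. -/
def WeakNull {E : Type*} [NormedAddCommGroup E] [NormedSpace ℝ E] (x : ℕ → E) : Prop :=
  ∀ f : E →L[ℝ] ℝ, Tendsto (fun n => f (x n)) atTop (nhds 0)

/-- Property (M). -/
def PropertyM (E : Type*) [NormedAddCommGroup E] [NormedSpace ℝ E] : Prop :=
  ∀ x : ℕ → E, WeakNull x → ∀ u v : E, ‖u‖ ≤ ‖v‖ →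
    Filter.limsup (fun n => ‖x n + u‖) atTop ≤ Filter.limsup (fun n => ‖x n + v‖) atTop

/-- `F` embeds isomorphically into `E`. -/
def EmbedsIso (F E : Type*) [NormedAddCommGroup F] [NormedSpace ℝ F]
    [NormedAddCommGroup E] [NormedSpace ℝ E] : Prop :=
  ∃ T : F →L[ℝ] E, Function.Injective T ∧ ∃ c > (0 : ℝ), ∀ y, c * ‖y‖ ≤ ‖T y‖

/-- Weak normal structure. -/
def WeakNormalStructure (E : Type*) [NormedAddCommGroup E] [NormedSpace ℝ E] : Prop :=
  ∀ C : Set E, Convex ℝ C → IsCompact (toWeakSpace ℝ E '' C) → C.Nontrivial →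
    ∃ x ∈ C, sSup ((fun y => ‖x - y‖) '' C) < Metric.diam C

/-- Property (K). -/
def PropertyK (E : Type*) [NormedAddCommGroup E] [NormedSpace ℝ E] : Prop :=
  ∃ K : ℝ, 0 ≤ K ∧ K < 1 ∧ ∀ (x : ℕ → E) (y : E), WeakNull x →
    Tendsto (fun n => ‖x n‖) atTop (nhds 1) →
    Filter.liminf (fun n => ‖x n - y‖) atTop ≤ 1 → ‖y‖ ≤ K

/-- Kadec-Klee norm. -/
def KadecKlee (E : Type*) [NormedAddCommGroup E] [NormedSpace ℝ E] : Prop :=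
  ∀ (x : ℕ → E) (y : E),
    (∀ f : E →L[ℝ] ℝ, Tendsto (fun n => f (x n)) atTop (nhds (f y))) →
    Tendsto (fun n => ‖x n‖) atTop (nhds ‖y‖) →
    Tendsto (fun n => ‖x n - y‖) atTop (nhds 0)

/-- Opial's modulus. -/
noncomputable def opialModulus (E : Type*) [NormedAddCommGroup E] [NormedSpace ℝ E]
    (c : ℝ) : ℝ :=
  sInf { r : ℝ | ∃ (x : ℕ → E) (y : E), c ≤ ‖y‖ ∧ WeakNull x ∧
    1 ≤ Filter.liminf (fun n => ‖x n‖) atTop ∧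
    r = Filter.liminf (fun n => ‖x n - y‖) atTop - 1 }

/-- A sequence of functionals converges weak-star to zero. -/
def WeakStarNull {E : Type*} [NormedAddCommGroup E] [NormedSpace ℝ E]
    (f : ℕ → (E →L[ℝ] ℝ)) : Prop :=
  ∀ x : E, Tendsto (fun n => f n x) atTop (nhds 0)

/-- Property (M*) of the dual. -/
def PropertyMStar (E : Type*) [NormedAddCommGroup E] [NormedSpace ℝ E] : Prop :=
  ∀ f : ℕ → (E →L[ℝ] ℝ), WeakStarNull f → ∀ u v : E →L[ℝ] ℝ, ‖u‖ ≤ ‖v‖ →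
    Filter.limsup (fun n => ‖f n + u‖) atTop ≤ Filter.limsup (fun n => ‖f n + v‖) atTop

/-- Property (K*) of the dual. -/
def PropertyKStar (E : Type*) [NormedAddCommGroup E] [NormedSpace ℝ E] : Prop :=
  ∃ K : ℝ, 0 ≤ K ∧ K < 1 ∧ ∀ (f : ℕ → (E →L[ℝ] ℝ)) (g : E →L[ℝ] ℝ), WeakStarNull f →
    Tendsto (fun n => ‖f n‖) atTop (nhds 1) →
    Filter.liminf (fun n => ‖f n - g‖) atTop ≤ 1 → ‖g‖ ≤ K

/-- weak* Kadec-Klee norm on the dual. -/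
def WeakStarKadecKlee (E : Type*) [NormedAddCommGroup E] [NormedSpace ℝ E] : Prop :=
  ∀ (f : ℕ → (E →L[ℝ] ℝ)) (g : E →L[ℝ] ℝ),
    (∀ x : E, Tendsto (fun n => f n x) atTop (nhds (g x))) →
    Tendsto (fun n => ‖f n‖) atTop (nhds ‖g‖) →
    Tendsto (fun n => ‖f n - g‖) atTop (nhds 0)

/-- weak* Opial modulus of the dual. -/
noncomputable def weakStarOpialModulus (E : Type*) [NormedAddCommGroup E] [NormedSpace ℝ E]
    (c : ℝ) : ℝ :=
  sInf { r : ℝ | ∃ (f : ℕ → (E →L[ℝ] ℝ)) (g : E →L[ℝ] ℝ), c ≤ ‖g‖ ∧ WeakStarNull f ∧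
    1 ≤ Filter.liminf (fun n => ‖f n‖) atTop ∧
    r = Filter.liminf (fun n => ‖f n - g‖) atTop - 1 }

/-- WORTH* for the dual. -/
def WORTHStar (E : Type*) [NormedAddCommGroup E] [NormedSpace ℝ E] : Prop :=
  ∀ f : ℕ → (E →L[ℝ] ℝ), WeakStarNull f → ∀ g : E →L[ℝ] ℝ,
    Tendsto (fun n => ‖f n - g‖ - ‖f n + g‖) atTop (nhds 0)

/-- Reflexivity of a normed space. -/
def IsReflexive (E : Type*) [NormedAddCommGroup E] [NormedSpace ℝ E] : Prop :=
  Function.Surjective (NormedSpace.inclusionInDoubleDual ℝ E)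

/-- The fixed point property for nonexpansive maps. -/
def FPP (E : Type*) [NormedAddCommGroup E] [NormedSpace ℝ E] : Prop :=
  ∀ C : Set E, C.Nonempty → IsClosed C → Bornology.IsBounded C → Convex ℝ C →
    ∀ T : E → E, Set.MapsTo T C C →
      (∀ x ∈ C, ∀ y ∈ C, ‖T x - T y‖ ≤ ‖x - y‖) → ∃ x ∈ C, T x = x

/-- `E` contains an asymptotically isometric copy of `c₀`. -/
def ContainsAsympIsoC0 (E : Type*) [NormedAddCommGroup E] [NormedSpace ℝ E] : Prop :=
  ∃ ε : ℕ → ℝ, (∀ n, ε n ∈ Set.Ioo (0 : ℝ) 1) ∧ Tendsto ε atTop (nhds 0) ∧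
    ∃ x : ℕ → E, ∀ t : ℕ →₀ ℝ,
      (∀ n, (1 - ε n) * |t n| ≤ ‖∑ n ∈ t.support, t n • x n‖) ∧
      ‖∑ n ∈ t.support, t n • x n‖ ≤ ⨆ n, |t n|

/-- `E` contains an asymptotically isometric copy of `ℓ₁`. -/
def ContainsAsympIsoL1 (E : Type*) [NormedAddCommGroup E] [NormedSpace ℝ E] : Prop :=
  ∃ ε : ℕ → ℝ, (∀ n, ε n ∈ Set.Ioo (0 : ℝ) 1) ∧ Tendsto ε atTop (nhds 0) ∧
    ∃ x : ℕ → E, ∀ t : ℕ →₀ ℝ,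
      (∑ n ∈ t.support, (1 - ε n) * |t n| ≤ ‖∑ n ∈ t.support, t n • x n‖) ∧
      ‖∑ n ∈ t.support, t n • x n‖ ≤ ∑ n ∈ t.support, |t n|


section Combinatorics

/-- The pairs `(A n, B n)`, `n ∈ M`, converge on `C` if no point of `C` lies in infinitely many
`A n` and infinitely many `B n` with `n ∈ M`. -/
def ConvergesOn {S : Type*} (A B : ℕ → Set S) (M : Set ℕ) (C : Set S) : Prop :=
  ∀ s ∈ C, {n ∈ M | s ∈ A n}.Finite ∨ {n ∈ M | s ∈ B n}.Finite

theorem ConvergesOn.of_diff_finite {S : Type*} {A B : ℕ → Set S} {M N : Set ℕ} {C : Set S}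
    (h : ConvergesOn A B M C) (hN : (N \ M).Finite) : ConvergesOn A B N C := by
  intro s hs
  refine (h s hs).imp (fun h => (h.union hN).subset ?_) (fun h => (h.union hN).subset ?_) <;>
  · rintro n ⟨hn, hsn⟩
    by_cases hM : n ∈ M
    · exact Or.inl ⟨hM, hsn⟩
    · exact Or.inr ⟨hn, hM⟩

/-- A diagonal argument for countably many properties of infinite sets of naturals which are
hereditary modulo finite sets. -/
theorem exists_infinite_subset_forall {P : ℕ → Set ℕ → Prop}
    (hP : ∀ k M N, P k M → (N \ M).Finite → P k N) {M : Set ℕ} (hM : M.Infinite)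
    (h : ∀ k, ∀ N ⊆ M, N.Infinite → ∃ N' ⊆ N, N'.Infinite ∧ P k N') :
    ∃ N ⊆ M, N.Infinite ∧ ∀ k, P k N := by
  choose! next hsub hinf hnext using h
  let Q : ℕ → Set ℕ := fun k => Nat.rec M (fun k N => next k N) k
  have hQs : ∀ k, Q (k + 1) = next k (Q k) := fun k => rfl
  have hQ : ∀ k, Q k ⊆ M ∧ (Q k).Infinite := by
    intro k
    induction k with
    | zero => exact ⟨subset_rfl, hM⟩
    | succ k ih =>
      rw [hQs]
      exact ⟨(hsub k _ ih.1 ih.2).trans ih.1, hinf k _ ih.1 ih.2⟩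
  have hanti : Antitone Q := antitone_nat_of_succ_le fun k => by
    rw [hQs]
    exact hsub k _ (hQ k).1 (hQ k).2
  obtain ⟨θ, hθ, hθQ⟩ := extraction_forall_of_frequently
    (P := fun k n => n ∈ Q k) fun k => Nat.frequently_atTop_iff_infinite.2 (hQ k).2
  refine ⟨Set.range θ, ?_, Set.infinite_range_of_injective hθ.injective, fun k => ?_⟩
  · rintro _ ⟨k, rfl⟩
    exact (hQ k).1 (hθQ k)
  · refine hP k (Q (k + 1)) _ (hnext k _ (hQ k).1 (hQ k).2) ?_
    refine ((Set.finite_lt_nat (k + 1)).image θ).subset ?_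
    rintro _ ⟨⟨i, rfl⟩, hi⟩
    refine ⟨i, ?_, rfl⟩
    by_contra hk
    exact hi (hanti (not_lt.1 hk) (hθQ i))

/-- If no infinite subset of `M` gives convergence on a cell of a finite family, then the cells
can be split by some pair `(A n, B n)` while keeping this property on an infinite subset. -/
theorem exists_split {S : Type*} (A B : ℕ → Set S) {𝒞 : Set (Set S)} (h𝒞 : 𝒞.Finite)
    {M : Set ℕ} (hM : M.Infinite)
    (h : ∀ N ⊆ M, N.Infinite → ∀ C ∈ 𝒞, ¬ ConvergesOn A B N C) :
    ∃ n, ∃ M' ⊆ M, M'.Infinite ∧ ∀ N ⊆ M', N.Infinite → ∀ C ∈ 𝒞,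
      ¬ ConvergesOn A B N (C ∩ A n) ∧ ¬ ConvergesOn A B N (C ∩ B n) := by
  by_contra! hcon
  obtain ⟨N, hNM, hN, hconv⟩ := exists_infinite_subset_forall
    (P := fun n N => ∃ C ∈ 𝒞, ConvergesOn A B N (C ∩ A n) ∨ ConvergesOn A B N (C ∩ B n))
    (fun n M N ⟨C, hC, h⟩ hMN =>
      ⟨C, hC, h.imp (fun h => h.of_diff_finite hMN) (fun h => h.of_diff_finite hMN)⟩) hM
    (fun n M' hM' hinf => by
      obtain ⟨N, hN, hNinf, C, hC, h⟩ := hcon n M' hM' hinf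
      exact ⟨N, hN, hNinf, C, hC, or_iff_not_imp_left.2 h⟩)
  have hfin : ∀ C ∈ 𝒞, ({n ∈ N | ConvergesOn A B N (C ∩ A n)} ∪
      {n ∈ N | ConvergesOn A B N (C ∩ B n)}).Finite := by
    intro C hC
    have hsub : ∀ (D : ℕ → Set S) (p : ℕ → Prop) (s : S), {n ∈ N | s ∈ D n}.Finite →
        {n ∈ {n ∈ N | p n} | s ∈ D n}.Finite :=
      fun D p s hD => hD.subset fun n hn => ⟨hn.1.1, hn.2⟩
    refine Set.Finite.union ?_ ?_ <;> by_contra hI <;>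
      refine h _ ((Set.sep_subset _ _).trans hNM) hI C hC fun s hs => ?_
    · by_cases hne : {n ∈ {n ∈ N | ConvergesOn A B N (C ∩ A n)} | s ∈ A n}.Nonempty
      · obtain ⟨n, hn, hsn⟩ := hne
        exact (hn.2 s ⟨hs, hsn⟩).imp (hsub A _ s) (hsub B _ s)
      · rw [Set.not_nonempty_iff_eq_empty.1 hne]
        exact Or.inl Set.finite_empty
    · by_cases hne : {n ∈ {n ∈ N | ConvergesOn A B N (C ∩ B n)} | s ∈ B n}.Nonempty
      · obtain ⟨n, hn, hsn⟩ := hne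
        exact (hn.2 s ⟨hs, hsn⟩).imp (hsub A _ s) (hsub B _ s)
      · rw [Set.not_nonempty_iff_eq_empty.1 hne]
        exact Or.inr Set.finite_empty
  refine hN ((h𝒞.biUnion hfin).subset fun n hn => ?_)
  obtain ⟨C, hC, h⟩ := hconv n
  exact Set.mem_biUnion hC (h.imp (fun h => ⟨hn, h⟩) (fun h => ⟨hn, h⟩))

/-- If no infinite set of indices gives convergence on a cell, then the pairs have an
independent subfamily. -/
theorem exists_independent {S : Type*} (A B : ℕ → Set S) {M : Set ℕ} (hM : M.Infinite)
    (h : ∀ N ⊆ M, N.Infinite → ¬ ConvergesOn A B N Set.univ) :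
    ∃ n : ℕ → ℕ, ∀ (p : ℕ → Prop) (k : ℕ),
      ∃ s, ∀ i < k, (p i → s ∈ A (n i)) ∧ (¬ p i → s ∈ B (n i)) := by
  let State := {q : Set (Set S) × Set ℕ // q.1.Finite ∧ q.2.Infinite ∧
    ∀ N ⊆ q.2, N.Infinite → ∀ C ∈ q.1, ¬ ConvergesOn A B N C}
  have step : ∀ q : State, ∃ n, ∃ r : State, ∀ C ∈ q.1.1, C ∩ A n ∈ r.1.1 ∧ C ∩ B n ∈ r.1.1 := by
    rintro ⟨⟨𝒞, M⟩, h𝒞, hM, hq⟩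
    obtain ⟨n, M', -, hinf, hM'⟩ := exists_split A B h𝒞 hM hq
    refine ⟨n, ⟨⟨(· ∩ A n) '' 𝒞 ∪ (· ∩ B n) '' 𝒞, M'⟩,
      (h𝒞.image _).union (h𝒞.image _), hinf, ?_⟩, fun C hC =>
        ⟨Or.inl ⟨C, hC, rfl⟩, Or.inr ⟨C, hC, rfl⟩⟩⟩
    rintro N hN hNinf _ (⟨C, hC, rfl⟩ | ⟨C, hC, rfl⟩)
    · exact (hM' N hN hNinf C hC).1
    · exact (hM' N hN hNinf C hC).2
  choose idx next hnext using step
  let q₀ : State := ⟨⟨{Set.univ}, M⟩, Set.finite_singleton _, hM, fun N hN hNinf C hC => by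
    rw [Set.mem_singleton_iff.1 hC]
    exact h N hN hNinf⟩
  let q : ℕ → State := fun k => Nat.rec q₀ (fun _ r => next r) k
  have hqs : ∀ k, q (k + 1) = next (q k) := fun k => rfl
  refine ⟨fun k => idx (q k), fun p k => ?_⟩
  have key : ∃ C ∈ (q k).1.1, ∀ s ∈ C, ∀ i < k,
      (p i → s ∈ A (idx (q i))) ∧ (¬ p i → s ∈ B (idx (q i))) := by
    induction k with
    | zero => exact ⟨Set.univ, rfl, fun s _ i hi => absurd hi (Nat.not_lt_zero i)⟩
    | succ k ih =>
      obtain ⟨C, hC, hCs⟩ := ih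
      by_cases hp : p k
      · refine ⟨C ∩ A (idx (q k)), hqs k ▸ (hnext (q k) C hC).1, fun s hs i hi => ?_⟩
        rcases Nat.lt_succ_iff_lt_or_eq.1 hi with hi | rfl
        · exact hCs s hs.1 i hi
        · exact ⟨fun _ => hs.2, fun h => absurd hp h⟩
      · refine ⟨C ∩ B (idx (q k)), hqs k ▸ (hnext (q k) C hC).2, fun s hs i hi => ?_⟩
        rcases Nat.lt_succ_iff_lt_or_eq.1 hi with hi | rfl
        · exact hCs s hs.1 i hi
        · exact ⟨fun h => absurd h hp, fun _ => hs.2⟩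
  obtain ⟨C, hC, hCs⟩ := key
  obtain ⟨s, hs⟩ : C.Nonempty := by
    by_contra hne
    refine (q k).2.2.2 _ subset_rfl (q k).2.2.1 C hC fun s hs => absurd ⟨s, hs⟩ hne
  exact ⟨s, hCs s hs⟩

end Combinatorics

section EllOne

variable {X : Type*} [NormedAddCommGroup X] [NormedSpace ℝ X]

theorem lp_one_hasSum_norm (a : lp (fun _ : ℕ => ℝ) 1) : HasSum (fun i => |a i|) ‖a‖ := by
  simpa using lp.hasSum_norm (by simp) a

/-- A bounded sequence with a lower `ℓ₁`-estimate spans a copy of `ℓ₁`. -/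
theorem embedsIso_of_lower_estimate [CompleteSpace X] {x : ℕ → X} (hx : ∀ n, ‖x n‖ ≤ 1)
    {c : ℝ} (hc : 0 < c)
    (h : ∀ (s : Finset ℕ) (a : ℕ → ℝ), c * ∑ i ∈ s, |a i| ≤ ‖∑ i ∈ s, a i • x i‖) :
    EmbedsIso (lp (fun _ : ℕ => ℝ) 1) X := by
  have hle : ∀ (a : lp (fun _ : ℕ => ℝ) 1) i, ‖a i • x i‖ ≤ |a i| := fun a i => by
    rw [norm_smul, Real.norm_eq_abs]
    exact mul_le_of_le_one_right (abs_nonneg _) (hx i)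
  have hsum : ∀ a : lp (fun _ : ℕ => ℝ) 1, Summable fun i => a i • x i := fun a =>
    Summable.of_norm_bounded (lp_one_hasSum_norm a).summable (hle a)
  let L : lp (fun _ : ℕ => ℝ) 1 →ₗ[ℝ] X :=
    { toFun := fun a => ∑' i, a i • x i
      map_add' := fun a b => by
        rw [← (hsum a).tsum_add (hsum b)]
        exact tsum_congr fun i => by rw [lp.coeFn_add, Pi.add_apply, add_smul]
      map_smul' := fun r a => by
        rw [RingHom.id_apply, ← (hsum a).tsum_const_smul]
        exact tsum_congr fun i => by rw [lp.coeFn_smul, Pi.smul_apply, smul_assoc] }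
  have hL : ∀ a, ‖L a‖ ≤ 1 * ‖a‖ := fun a => by
    rw [one_mul]
    exact tsum_of_norm_bounded (lp_one_hasSum_norm a) (hle a)
  have hlow : ∀ a, c * ‖a‖ ≤ ‖L a‖ := fun a =>
    le_of_tendsto_of_tendsto' ((lp_one_hasSum_norm a).const_mul c) (hsum a).hasSum.norm
      fun s => by simpa only [Finset.mul_sum] using h s a
  refine ⟨L.mkContinuous 1 hL, ?_, c, hc, hlow⟩
  refine (injective_iff_map_eq_zero _).2 fun a ha => ?_
  have h0 := hlow a
  rw [show L a = 0 from ha, norm_zero] at h0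
  exact norm_le_zero_iff.1 (nonpos_of_mul_nonpos_right h0 hc)

/-- Functionals separating all finite sign patterns yield a lower `ℓ₁`-estimate. -/
theorem lower_estimate_of_independent {x : ℕ → X} {p q : ℝ}
    (h : ∀ (P : ℕ → Prop) (k : ℕ), ∃ φ : X →L[ℝ] ℝ, ‖φ‖ ≤ 1 ∧
      ∀ i < k, (P i → q < φ (x i)) ∧ (¬ P i → φ (x i) < p))
    (s : Finset ℕ) (a : ℕ → ℝ) :
    (q - p) / 2 * ∑ i ∈ s, |a i| ≤ ‖∑ i ∈ s, a i • x i‖ := by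
  obtain ⟨k, hk⟩ := s.bddAbove
  obtain ⟨φ, hφ, hφx⟩ := h (fun i => 0 ≤ a i) (k + 1)
  obtain ⟨ψ, hψ, hψx⟩ := h (fun i => ¬ 0 ≤ a i) (k + 1)
  have hsum : (q - p) * ∑ i ∈ s, |a i| ≤ φ (∑ i ∈ s, a i • x i) - ψ (∑ i ∈ s, a i • x i) := by
    simp only [map_sum, map_smul, smul_eq_mul]
    rw [← Finset.sum_sub_distrib, Finset.mul_sum]
    refine Finset.sum_le_sum fun i hi => ?_
    have hik := Nat.lt_succ_of_le (hk hi)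
    by_cases hai : 0 ≤ a i
    · have h1 := (hφx i hik).1 hai
      have h2 := (hψx i hik).2 (not_not.2 hai)
      rw [abs_of_nonneg hai]
      nlinarith
    · have h1 := (hφx i hik).2 hai
      have h2 := (hψx i hik).1 hai
      rw [abs_of_neg (not_le.1 hai)]
      nlinarith
  have h1 := (le_abs_self _).trans (φ.le_of_opNorm_le hφ (∑ i ∈ s, a i • x i))
  have h2 := (neg_le_abs _).trans (ψ.le_of_opNorm_le hψ (∑ i ∈ s, a i • x i))
  linarith

/-- **Rosenthal's `ℓ₁` theorem**: a bounded sequence in a Banach space without a copy of `ℓ₁` has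
a weakly Cauchy subsequence. -/
theorem exists_weaklyCauchy_subseq [CompleteSpace X]
    (hl : ¬ EmbedsIso (lp (fun _ : ℕ => ℝ) 1) X) {x : ℕ → X} (hx : ∀ n, ‖x n‖ ≤ 1) :
    ∃ θ : ℕ → ℕ, StrictMono θ ∧
      ∀ φ : X →L[ℝ] ℝ, ∃ l, Tendsto (fun n => φ (x (θ n))) atTop (𝓝 l) := by
  let A : ℚ → ℕ → Set {φ : X →L[ℝ] ℝ // ‖φ‖ ≤ 1} := fun q n => {φ | (q : ℝ) < φ.1 (x n)}
  let B : ℚ → ℕ → Set {φ : X →L[ℝ] ℝ // ‖φ‖ ≤ 1} := fun p n => {φ | φ.1 (x n) < (p : ℝ)}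
  have hconv : ∀ p q : ℚ, p < q → ∀ M : Set ℕ, M.Infinite →
      ∃ N ⊆ M, N.Infinite ∧ ConvergesOn (A q) (B p) N Set.univ := by
    intro p q hpq M hM
    by_contra! hcon
    obtain ⟨n, hn⟩ := exists_independent (A q) (B p) hM hcon
    refine hl (embedsIso_of_lower_estimate (x := x ∘ n) (fun i => hx _)
      (c := ((q : ℝ) - p) / 2) (by have : (p : ℝ) < q := by exact_mod_cast hpq
                                   linarith)
      (lower_estimate_of_independent fun P k => ?_))
    obtain ⟨φ, hφ⟩ := hn P k
    exact ⟨φ.1, φ.2, hφ⟩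
  obtain ⟨e, he⟩ := exists_surjective_nat (ℚ × ℚ)
  obtain ⟨N, -, hN, hNconv⟩ := exists_infinite_subset_forall
    (P := fun k N => (e k).1 < (e k).2 → ConvergesOn (A (e k).2) (B (e k).1) N Set.univ)
    (fun k M N h hMN hlt => (h hlt).of_diff_finite hMN) Set.infinite_univ
    (fun k M _ hM => by
      by_cases hlt : (e k).1 < (e k).2
      · obtain ⟨N, hN, hinf, h⟩ := hconv _ _ hlt M hM
        exact ⟨N, hN, hinf, fun _ => h⟩
      · exact ⟨M, subset_rfl, hM, fun h => absurd h hlt⟩)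
  refine ⟨Nat.nth (· ∈ N), Nat.nth_strictMono hN, fun φ => ?_⟩
  have hball : ∀ φ : X →L[ℝ] ℝ, ‖φ‖ ≤ 1 →
      ∃ l, Tendsto (fun n => φ (x (Nat.nth (· ∈ N) n))) atTop (𝓝 l) := by
    intro φ hφ
    have hbd : ∀ n, |φ (x (Nat.nth (· ∈ N) n))| ≤ 1 := fun n =>
      (φ.le_of_opNorm_le hφ _).trans (by rw [one_mul]; exact hx _)
    have hfreq : ∀ r : ℕ → Prop, (∃ᶠ n in atTop, r (Nat.nth (· ∈ N) n)) →
        {n ∈ N | r n}.Infinite := by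
      intro r hr
      refine ((Nat.frequently_atTop_iff_infinite.1 hr).image
        (Nat.nth_injective hN).injOn).mono ?_
      rintro _ ⟨n, hn, rfl⟩
      exact ⟨Nat.nth_mem_of_infinite hN n, hn⟩
    refine tendsto_of_no_upcrossings Rat.isDenseEmbedding_coe_real.dense ?_
      (isBoundedUnder_of ⟨1, fun n => (abs_le.1 (hbd n)).2⟩)
      (isBoundedUnder_of ⟨-1, fun n => (abs_le.1 (hbd n)).1⟩)
    rintro _ ⟨p, rfl⟩ _ ⟨q, rfl⟩ hpq ⟨h1, h2⟩
    obtain ⟨k, hk⟩ := he (p, q)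
    have h := hNconv k
    rw [hk] at h
    rcases h (by exact_mod_cast hpq) ⟨φ, hφ⟩ (Set.mem_univ _) with h | h
    · exact hfreq (fun n => (q : ℝ) < φ (x n)) h2 h
    · exact hfreq (fun n => φ (x n) < (p : ℝ)) h1 h
  have hpos : 0 < ‖φ‖ + 1 := by positivity
  obtain ⟨l, hl⟩ := hball ((‖φ‖ + 1)⁻¹ • φ) (by
    rw [norm_smul, norm_inv, Real.norm_of_nonneg hpos.le, inv_mul_le_iff₀ hpos]
    linarith)
  refine ⟨(‖φ‖ + 1) * l, (hl.const_mul (‖φ‖ + 1)).congr fun n => ?_⟩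
  simp [hpos.ne']

end EllOne

section KadecKlee

variable {X : Type*} [NormedAddCommGroup X] [NormedSpace ℝ X]

/-- Weak* Kadec-Klee duals of separable spaces are separable. -/
theorem WeakStarKadecKlee.separableSpace [TopologicalSpace.SeparableSpace X]
    (h : WeakStarKadecKlee X) : TopologicalSpace.SeparableSpace (X →L[ℝ] ℝ) := by
  let d := TopologicalSpace.denseSeq X
  let Φ : (X →L[ℝ] ℝ) → (ℕ → ℝ) × ℝ := fun f => (fun k => f (d k), ‖f‖)
  have : Nonempty (Set.range Φ) := ⟨⟨Φ 0, 0, rfl⟩⟩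
  choose g hg using fun n => (TopologicalSpace.denseSeq (Set.range Φ) n).2
  refine ⟨Set.range g, Set.countable_range g, fun f => ?_⟩
  obtain ⟨u, hu, hlim⟩ := mem_closure_iff_seq_limit.1
    (TopologicalSpace.denseRange_denseSeq (Set.range Φ) ⟨Φ f, f, rfl⟩)
  choose m hm using hu
  have hΦ : Tendsto (fun n => Φ (g (m n))) atTop (𝓝 (Φ f)) := by
    refine ((continuous_subtype_val.tendsto _).comp hlim).congr fun n => ?_
    rw [Function.comp_apply, ← hm n, hg]
  have hnorm : Tendsto (fun n => ‖g (m n)‖) atTop (𝓝 ‖f‖) := (continuous_snd.tendsto _).comp hΦ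
  have hdense : ∀ k, Tendsto (fun n => g (m n) (d k)) atTop (𝓝 (f (d k))) := fun k =>
    ((continuous_apply k).comp continuous_fst).tendsto _ |>.comp hΦ
  have hweak : ∀ x : X, Tendsto (fun n => g (m n) x) atTop (𝓝 (f x)) := by
    intro x
    rw [Metric.tendsto_atTop]
    intro ε hε
    have hC : 0 < 2 * ‖f‖ + 2 := by positivity
    obtain ⟨k, hk⟩ := (TopologicalSpace.denseRange_denseSeq X).exists_dist_lt x
      (show 0 < ε / 2 / (2 * ‖f‖ + 2) by positivity)
    rw [dist_eq_norm, lt_div_iff₀ hC] at hk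
    obtain ⟨n₀, hn₀⟩ := eventually_atTop.1
      ((hnorm.eventually_lt_const (show ‖f‖ < ‖f‖ + 1 by linarith)).and
        ((Metric.tendsto_nhds.1 (hdense k)) (ε / 2) (by positivity)))
    refine ⟨n₀, fun n hn => ?_⟩
    obtain ⟨h1, h2⟩ := hn₀ n hn
    rw [Real.dist_eq] at h2 ⊢
    have e : g (m n) x - f x = g (m n) (x - d k) + (g (m n) (d k) - f (d k)) - f (x - d k) := by
      simp only [map_sub]
      ring
    have b1 := (g (m n)).le_opNorm (x - d k)
    have b2 := f.le_opNorm (x - d k)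
    rw [Real.norm_eq_abs] at b1 b2
    have b3 : |g (m n) x - f x| ≤
        |g (m n) (x - d k)| + |g (m n) (d k) - f (d k)| + |f (x - d k)| := by
      rw [e]
      exact (abs_sub _ _).trans (add_le_add_left (abs_add_le _ _) _)
    nlinarith [norm_nonneg (x - d k), norm_nonneg f]
  have hlast := h _ f hweak hnorm
  refine mem_closure_iff_seq_limit.2 ⟨fun n => g (m n), fun n => ⟨m n, rfl⟩, ?_⟩
  exact tendsto_iff_norm_sub_tendsto_zero.2 hlast

/-- A weakly null sequence cannot satisfy a uniform lower `ℓ₁`-estimate relative to every vector. -/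
theorem not_forall_add_le_limsup [CompleteSpace X] {y : ℕ → X} (hy : WeakNull y) {R δ : ℝ}
    (hR : ∀ n, ‖y n‖ ≤ R) (hδ : 0 < δ)
    (h : ∀ (v : X) (s : ℝ), 0 < s → ‖v‖ + s * δ ≤ limsup (fun n => ‖s • y n + v‖) atTop) :
    False := by
  have step : ∀ (v : X) (N : ℕ) (s : ℝ), 0 < s →
      ∃ n, N ≤ n ∧ ‖v‖ + s * (3 / 4 * δ) < ‖s • y n + v‖ := by
    intro v N s hs
    have hlt : ‖v‖ + s * (3 / 4 * δ) < limsup (fun n => ‖s • y n + v‖) atTop :=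
      lt_of_lt_of_le (by nlinarith) (h v s hs)
    have hcob : IsCoboundedUnder (· ≤ ·) atTop fun n => ‖s • y n + v‖ :=
      (isBoundedUnder_of ⟨0, fun n => norm_nonneg _⟩).isCoboundedUnder_le
    exact frequently_atTop.1 (frequently_lt_of_lt_limsup hcob hlt) N
  choose! pick hpick hlt using step
  have hR0 : 0 ≤ R := (norm_nonneg _).trans (hR 0)
  obtain ⟨r, hr0, hr1, hr⟩ : ∃ r : ℝ, 0 < r ∧ r < 1 ∧ R * r / (1 - r) ≤ δ / 4 := by
    have hD : 0 < 4 * (R + δ) := by linarith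
    have hr1 : δ / (4 * (R + δ)) < 1 := by
      rw [div_lt_one hD]
      linarith
    refine ⟨δ / (4 * (R + δ)), by positivity, hr1, ?_⟩
    rw [div_le_iff₀ (by linarith), mul_div_assoc', div_le_iff₀ hD]
    have e : δ / 4 * (1 - δ / (4 * (R + δ))) * (4 * (R + δ)) = δ / 4 * (4 * (R + δ) - δ) := by
      field_simp
    rw [e]
    nlinarith
  let S : ℕ → X × ℕ := fun k => Nat.rec (0, 0)
    (fun k p => (r ^ k • y (pick p.1 p.2 (r ^ k)) + p.1, pick p.1 p.2 (r ^ k) + 1)) k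
  let m : ℕ → ℕ := fun k => pick (S k).1 (S k).2 (r ^ k)
  let v : ℕ → X := fun k => (S k).1
  have hv : ∀ k, v (k + 1) = r ^ k • y (m k) + v k := fun k => rfl
  have hS : ∀ k, (S (k + 1)).2 = m k + 1 := fun k => rfl
  have hm' : ∀ k, (S k).2 ≤ m k := fun k => hpick _ _ _ (pow_pos hr0 k)
  have hm : ∀ k, k ≤ (S k).2 := by
    intro k
    induction k with
    | zero => exact Nat.zero_le _
    | succ k ih =>
      rw [hS]
      exact Nat.succ_le_succ (ih.trans (hm' k))
  have hgrow : ∀ k, ‖v k‖ + r ^ k * (3 / 4 * δ) < ‖v (k + 1)‖ := fun k =>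
    hlt _ _ _ (pow_pos hr0 k)
  have hdist : ∀ k, dist (v k) (v (k + 1)) ≤ R * r ^ k := fun k => by
    rw [dist_comm, dist_eq_norm, hv, add_sub_cancel_right, norm_smul,
      Real.norm_of_nonneg (pow_pos hr0 k).le, mul_comm]
    exact mul_le_mul_of_nonneg_right (hR _) (pow_pos hr0 k).le
  obtain ⟨w, hw⟩ := cauchySeq_tendsto_of_complete (cauchySeq_of_le_geometric r R hr1 hdist)
  have hmono : Monotone fun k => ‖v k‖ := monotone_nat_of_le_succ fun k =>
    le_trans (le_add_of_nonneg_right (by positivity)) (hgrow k).le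
  obtain ⟨φ, hφ, hφw⟩ := exists_dual_vector'' ℝ w
  have hφy : ∀ k, δ / 2 ≤ φ (y (m k)) := by
    intro k
    have hrk := pow_pos hr0 k
    have htail : ‖w - v (k + 1)‖ ≤ r ^ k * (δ / 4) := by
      have h1 := dist_le_of_le_geometric_of_tendsto r R hr1 hdist hw (k + 1)
      rw [dist_comm, dist_eq_norm] at h1
      refine h1.trans ?_
      rw [show R * r ^ (k + 1) / (1 - r) = r ^ k * (R * r / (1 - r)) by ring]
      exact mul_le_mul_of_nonneg_left hr hrk.le
    have h1 : ‖v (k + 1)‖ ≤ ‖w‖ := hmono.ge_of_tendsto hw.norm (k + 1)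
    have h2 := (le_abs_self _).trans (φ.le_of_opNorm_le hφ (w - v (k + 1)))
    have h3 := (le_abs_self _).trans (φ.le_of_opNorm_le hφ (v k))
    have h4 := hgrow k
    have h5 : φ (v (k + 1)) = r ^ k * φ (y (m k)) + φ (v k) := by
      rw [hv, map_add, map_smul, smul_eq_mul]
    rw [map_sub, hφw] at h2
    refine le_of_mul_le_mul_left ?_ hrk
    simp only [RCLike.ofReal_real_eq_id, id_eq] at h2
    linarith
  have hlim := (hy φ).comp (tendsto_atTop_mono (fun k => (hm k).trans (hm' k)) tendsto_id)
  have := ge_of_tendsto' hlim hφy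
  linarith

theorem exists_lt_apply_of_lt_norm {f : X →L[ℝ] ℝ} {r : ℝ} (hr : r < ‖f‖) :
    ∃ x : X, ‖x‖ ≤ 1 ∧ r < f x := by
  obtain ⟨z, hz, hrz⟩ := f.exists_lt_apply_of_lt_opNorm hr
  rcases lt_abs.1 hrz with h | h
  · exact ⟨z, hz.le, h⟩
  · exact ⟨-z, (norm_neg z).trans_le hz.le, by rwa [map_neg]⟩

/-- In a space with Property (M) without a copy of `ℓ₁`, the dual norm is weak* Kadec-Klee. -/
theorem PropertyM.weakStarKadecKlee [CompleteSpace X] (hM : PropertyM X)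
    (hl : ¬ EmbedsIso (lp (fun _ : ℕ => ℝ) 1) X) : WeakStarKadecKlee X := by
  intro f g hfg hnorm
  by_contra hcon
  obtain ⟨δ, hδ, hfreq⟩ : ∃ δ > 0, ∃ᶠ n in atTop, δ < ‖f n - g‖ := by
    by_contra! hsmall
    refine hcon (tendsto_order.2 ⟨fun a ha => .of_forall fun n => ha.trans_le (norm_nonneg _),
      fun a ha => ?_⟩)
    filter_upwards [hsmall (a / 2) (half_pos ha)] with n hn
    linarith
  have hg : 0 < ‖g‖ := by
    refine (norm_nonneg g).lt_of_ne fun h0 => hcon ?_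
    have hg0 : g = 0 := norm_eq_zero.1 h0.symm
    simpa [hg0] using hnorm
  obtain ⟨ψ, hψ, hψδ⟩ := extraction_of_frequently_atTop hfreq
  choose x hx hxδ using fun n => exists_lt_apply_of_lt_norm (hψδ n)
  obtain ⟨θ, hθ, hcauchy⟩ := exists_weaklyCauchy_subseq hl hx
  have hψθ : Tendsto (fun n => ψ (θ n)) atTop atTop :=
    hψ.tendsto_atTop.comp hθ.tendsto_atTop
  have hρ : ∀ k, ∃ n, k ≤ n ∧ (f (ψ (θ n)) - g) (x (θ k)) < δ / 2 := by
    intro k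
    have h0 : Tendsto (fun n => (f (ψ (θ n)) - g) (x (θ k))) atTop (𝓝 0) := by
      simpa using ((hfg (x (θ k))).comp hψθ).sub_const (g (x (θ k)))
    exact ((eventually_ge_atTop k).and (h0.eventually_lt_const (half_pos hδ))).exists
  choose ρ hρk hρδ using hρ
  have hρlim : Tendsto ρ atTop atTop := tendsto_atTop_mono hρk tendsto_id
  let y : ℕ → X := fun k => x (θ (ρ k)) - x (θ k)
  let F : ℕ → X →L[ℝ] ℝ := fun k => f (ψ (θ (ρ k)))
  have hF : Tendsto (fun k => ψ (θ (ρ k))) atTop atTop := hψθ.comp hρlim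
  have hy : WeakNull y := by
    intro φ
    obtain ⟨l, hl⟩ := hcauchy φ
    simpa [y] using (hl.comp hρlim).sub hl
  have hyR : ∀ k, ‖y k‖ ≤ 2 := fun k =>
    (norm_sub_le _ _).trans (by linarith [hx (θ (ρ k)), hx (θ k)])
  have hFy : ∀ k, δ / 2 ≤ (F k - g) (y k) := fun k => by
    have h1 := hxδ (θ (ρ k))
    have h2 := hρδ k
    rw [map_sub]
    linarith
  refine not_forall_add_le_limsup hy hyR (div_pos (half_pos hδ) hg) fun v s hs => ?_
  have hbdd : ∀ u : X, IsBoundedUnder (· ≤ ·) atTop fun n => ‖s • y n + u‖ := fun u =>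
    isBoundedUnder_of ⟨s * 2 + ‖u‖, fun n => (norm_add_le _ _).trans (by
      rw [norm_smul, Real.norm_of_nonneg hs.le]
      gcongr
      exact hyR n)⟩
  have hlow : ∀ u : X, (g u + s * (δ / 2)) / ‖g‖ ≤ limsup (fun n => ‖s • y n + u‖) atTop := by
    intro u
    have hlim : Tendsto (fun k => (F k u + s * g (y k) + s * (δ / 2)) / ‖F k‖) atTop
        (𝓝 ((g u + s * (δ / 2)) / ‖g‖)) := by
      have h1 := (((hfg u).comp hF).add ((hy g).const_mul s)).add_const (s * (δ / 2))
      rw [mul_zero, add_zero] at h1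
      exact h1.div (hnorm.comp hF) hg.ne'
    rw [← hlim.limsup_eq]
    refine limsup_le_limsup ?_ hlim.isCoboundedUnder_le (hbdd u)
    filter_upwards [(hnorm.comp hF).eventually_const_lt hg] with k hk
    replace hk : 0 < ‖F k‖ := hk
    rw [div_le_iff₀ hk, mul_comm ‖s • y k + u‖]
    refine le_trans ?_ ((le_abs_self _).trans ((F k).le_opNorm _))
    have h1 := mul_le_mul_of_nonneg_left (hFy k) hs.le
    rw [sub_apply] at h1
    rw [map_add, map_smul, smul_eq_mul]
    linarith
  have hsnull : WeakNull fun n => s • y n := fun φ => by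
    simpa using (hy φ).const_mul s
  refine le_of_forall_pos_lt_add fun ε hε => ?_
  obtain ⟨u, hu, hgu⟩ : ∃ u : X, ‖u‖ ≤ ‖v‖ ∧ (‖v‖ - ε) * ‖g‖ < g u := by
    rcases eq_or_ne v 0 with rfl | hv
    · refine ⟨0, le_rfl, ?_⟩
      rw [norm_zero, map_zero]
      nlinarith
    · have hv0 : 0 < ‖v‖ := norm_pos_iff.2 hv
      have hlt : (‖v‖ - ε) / ‖v‖ * ‖g‖ < ‖g‖ :=
        mul_lt_of_lt_one_left hg ((div_lt_one hv0).2 (by linarith))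
      obtain ⟨z, hz, hgz⟩ := exists_lt_apply_of_lt_norm hlt
      refine ⟨‖v‖ • z, ?_, ?_⟩
      · rw [norm_smul, norm_norm]
        exact mul_le_of_le_one_right hv0.le hz
      · rw [map_smul, smul_eq_mul]
        rwa [div_mul_eq_mul_div, div_lt_iff₀ hv0, mul_comm (g z)] at hgz
  have h1 := (hlow u).trans (hM _ hsnull u v hu)
  rw [div_le_iff₀ hg] at h1
  have e : s * (δ / 2 / ‖g‖) * ‖g‖ = s * (δ / 2) := by field_simp
  nlinarith

end KadecKlee

theorem stmt10 (X : Type*) [NormedAddCommGroup X] [NormedSpace ℝ X] [CompleteSpace X]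
    [TopologicalSpace.SeparableSpace X]
    (hM : PropertyM X) (hl : ¬ EmbedsIso (lp (fun _ : ℕ => ℝ) 1) X) :
    TopologicalSpace.SeparableSpace (X →L[ℝ] ℝ) ∧ WeakStarKadecKlee X :=
  have h := hM.weakStarKadecKlee hl
  ⟨h.separableSpace, h⟩
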